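/- arXiv:1811.09149 — 5 statements merged into one kernel-verified Lean document; each statement's English description precedes it below -/
import Mathlib

section
/- Let A be an n×n matrix over ℚ, let u ∈ ℚⁿ be a nonzero vector, and let f ∈ ℚ[λ] be the minimal annihilating polynomial of u with respect to A. Let ψ_f(x,y) be the unique polynomial with (x − y)·ψ_f(x,y) = f(x) − f(y). If α ∈ ℂ is a root of f, then the vector φ(α) = ψ_f(A_ℂ, α·E)·u (where A_ℂ is A regarded as a complex matrix and u is regarded as a complex vector) is an eigenvector of A_ℂ associated to the eigenvalue α; that is, φ(α) ≠ 0 and A_ℂ·φ(α) = α·φ(α). -/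
open Polynomial Matrix

/-- if f is the minimal annihilating polynomial of a nonzero vector u
with respect to A, and α ∈ ℂ is a root of f, then φ(α) = ψ_f(A_ℂ, α·E)·u is an
eigenvector of A_ℂ associated to the eigenvalue α. -/
theorem stmt_0 {n : ℕ} (A : Matrix (Fin n) (Fin n) ℚ) (u : Fin n → ℚ) (hu : u ≠ 0)
    (f : Polynomial ℚ) (hmonic : f.Monic)
    (hmin : ∀ P : Polynomial ℚ, (Polynomial.aeval A P) *ᵥ u = 0 ↔ f ∣ P)
    (ψ : Polynomial (Polynomial ℚ))
    (hψ : (Polynomial.C Polynomial.X - Polynomial.X) * ψ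
        = Polynomial.C f - f.map Polynomial.C)
    (α : ℂ) (hα : Polynomial.aeval α f = 0) :
    (Polynomial.aeval (A.map (algebraMap ℚ ℂ))
        ((ψ.map (Polynomial.mapRingHom (algebraMap ℚ ℂ))).eval (Polynomial.C α)))
        *ᵥ (fun i => algebraMap ℚ ℂ (u i)) ≠ 0 ∧
    (A.map (algebraMap ℚ ℂ)) *ᵥ
        ((Polynomial.aeval (A.map (algebraMap ℚ ℂ))
          ((ψ.map (Polynomial.mapRingHom (algebraMap ℚ ℂ))).eval (Polynomial.C α)))
          *ᵥ (fun i => algebraMap ℚ ℂ (u i)))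
      = α • ((Polynomial.aeval (A.map (algebraMap ℚ ℂ))
          ((ψ.map (Polynomial.mapRingHom (algebraMap ℚ ℂ))).eval (Polynomial.C α)))
          *ᵥ (fun i => algebraMap ℚ ℂ (u i))) := by
  have hq : (X - C α) * ((ψ.map (Polynomial.mapRingHom (algebraMap ℚ ℂ))).eval (Polynomial.C α))
      = f.map (algebraMap ℚ ℂ) := by
    have h := congrArg (fun p : Polynomial (Polynomial ℚ) =>
      (p.map (Polynomial.mapRingHom (algebraMap ℚ ℂ))).eval (Polynomial.C α)) hψ
    simp only [Polynomial.map_mul, Polynomial.map_sub, Polynomial.map_C, Polynomial.map_X,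
      Polynomial.eval_mul, Polynomial.eval_sub, Polynomial.eval_C, Polynomial.eval_X,
      Polynomial.coe_mapRingHom, Polynomial.map_map] at h
    rw [h]
    have h2 : ((f.map ((Polynomial.mapRingHom (algebraMap ℚ ℂ)).comp C)).eval (C α) : ℂ[X]) = 0 := by
      have h3 : ((Polynomial.mapRingHom (algebraMap ℚ ℂ)).comp C)
          = (C : ℂ →+* ℂ[X]).comp (algebraMap ℚ ℂ) := by
        ext; simp
      rw [h3, Polynomial.eval_map, ← Polynomial.hom_eval₂, ← Polynomial.aeval_def, hα, map_zero]
    rw [h2, sub_zero]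
  generalize ((ψ.map (Polynomial.mapRingHom (algebraMap ℚ ℂ))).eval (Polynomial.C α)) = q at hq
  have hpow : ∀ j : ℕ, (A.map (algebraMap ℚ ℂ)) ^ j *ᵥ (fun i => algebraMap ℚ ℂ (u i))
      = fun i => algebraMap ℚ ℂ ((A ^ j *ᵥ u) i) := by
    intro j
    ext i
    rw [← Matrix.map_pow, RingHom.map_mulVec]
    rfl
  have hsum : ∀ (p : ℂ[X]) (N : ℕ), p.natDegree < N → ∀ i,
      ((aeval (A.map (algebraMap ℚ ℂ)) p) *ᵥ (fun i => algebraMap ℚ ℂ (u i))) i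
      = ∑ j ∈ Finset.range N, p.coeff j * algebraMap ℚ ℂ ((A ^ j *ᵥ u) i) := by
    intro p N hN i
    rw [Polynomial.aeval_eq_sum_range' hN, Matrix.sum_mulVec, Finset.sum_apply]
    refine Finset.sum_congr rfl fun j _ => ?_
    rw [Matrix.smul_mulVec, hpow]
    simp
  have hsumQ : ∀ (p : ℚ[X]) (N : ℕ), p.natDegree < N → ∀ i,
      ((aeval A p) *ᵥ u) i = ∑ j ∈ Finset.range N, p.coeff j * ((A ^ j *ᵥ u) i) := by
    intro p N hN i
    rw [Polynomial.aeval_eq_sum_range' hN, Matrix.sum_mulVec, Finset.sum_apply]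
    refine Finset.sum_congr rfl fun j _ => ?_
    rw [Matrix.smul_mulVec]
    simp
  constructor
  · intro h0
    have hqm : q.Monic := (monic_X_sub_C α).of_mul_monic_left (hq ▸ hmonic.map _)
    have hdeg : f.natDegree = q.natDegree + 1 := by
      have := congrArg natDegree hq
      rw [(monic_X_sub_C α).natDegree_mul hqm, natDegree_X_sub_C, natDegree_map] at this
      omega
    obtain ⟨L, hL⟩ := LinearMap.exists_leftInverse_of_injective (Algebra.linearMap ℚ ℂ)
      (LinearMap.ker_eq_bot.2 (algebraMap ℚ ℂ).injective)
    have hL1 : L 1 = 1 := by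
      have := LinearMap.congr_fun hL 1
      simpa using this
    set P : ℚ[X] := ∑ j ∈ Finset.range (q.natDegree + 1), monomial j (L (q.coeff j)) with hP
    have hPc : ∀ j ∈ Finset.range (q.natDegree + 1), P.coeff j = L (q.coeff j) := by
      intro j hj
      rw [hP, finset_sum_coeff]
      simp only [coeff_monomial]
      rw [Finset.sum_ite_eq' , if_pos hj]
    have hPd : P.natDegree < q.natDegree + 1 := by
      refine Nat.lt_succ_of_le (natDegree_sum_le_of_forall_le _ _ fun j hj => ?_)
      exact (natDegree_monomial_le _).trans (Nat.lt_succ_iff.1 (Finset.mem_range.1 hj))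
    have hP0 : P ≠ 0 := by
      intro h
      have := hPc q.natDegree (by simp)
      rw [hqm.coeff_natDegree, hL1, h] at this
      simp at this
    have hPu : (aeval A P) *ᵥ u = 0 := by
      ext i
      have h1 := congrArg L (congrFun h0 i)
      rw [hsum q _ (Nat.lt_succ_self _) i, map_sum] at h1
      rw [hsumQ P _ hPd i]
      simp only [Pi.zero_apply, map_zero] at h1 ⊢
      rw [← h1]
      refine Finset.sum_congr rfl fun j hj => ?_
      rw [hPc j hj, mul_comm (q.coeff j), ← Algebra.smul_def, map_smul, smul_eq_mul, mul_comm]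
    have := natDegree_le_of_dvd ((hmin P).1 hPu) hP0
    omega
  · have hf : (aeval (A.map (algebraMap ℚ ℂ)) (f.map (algebraMap ℚ ℂ))) *ᵥ
        (fun i => algebraMap ℚ ℂ (u i)) = 0 := by
      ext i
      rw [hsum _ (f.natDegree + 1) (by rw [natDegree_map]; omega) i]
      have h := hsumQ f _ (Nat.lt_succ_self _) i
      rw [(hmin f).2 dvd_rfl] at h
      have h' := congrArg (algebraMap ℚ ℂ) h
      rw [map_sum] at h'
      simp only [coeff_map, ← map_mul, Pi.zero_apply, map_zero] at h' ⊢
      exact h'.symm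
    rw [← hq, map_mul, ← Matrix.mulVec_mulVec, map_sub, aeval_X, aeval_C, Matrix.sub_mulVec,
      sub_eq_zero, Algebra.algebraMap_eq_smul_one, Matrix.smul_mulVec, Matrix.one_mulVec] at hf
    exact hf
end

section
/- Let A be an n×n matrix over ℚ, let f ∈ ℚ[λ] be a polynomial, and let u ∈ ℚⁿ satisfy f(A)·u = 0. If α ∈ ℂ is a root of f, then for every natural number k, A_ℂ^k·(ψ_f(A_ℂ, α·E)·u) = α^k·(ψ_f(A_ℂ, α·E)·u), where A_ℂ is A regarded as a complex matrix and u is regarded as a complex vector. -/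
open Polynomial Matrix

/-- if f(A)·u = 0 and α ∈ ℂ is a root of f, then
A_ℂ^k·(ψ_f(A_ℂ, α·E)·u) = α^k·(ψ_f(A_ℂ, α·E)·u) for every natural number k. -/
theorem stmt_8 {n : ℕ} (A : Matrix (Fin n) (Fin n) ℚ) (f : Polynomial ℚ)
    (u : Fin n → ℚ) (hfu : (Polynomial.aeval A f) *ᵥ u = 0)
    (ψ : Polynomial (Polynomial ℚ))
    (hψ : (Polynomial.C Polynomial.X - Polynomial.X) * ψ
        = Polynomial.C f - f.map Polynomial.C)
    (α : ℂ) (hα : Polynomial.aeval α f = 0) :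
    ∀ k : ℕ,
      ((A.map (algebraMap ℚ ℂ)) ^ k) *ᵥ
          ((Polynomial.aeval (A.map (algebraMap ℚ ℂ))
            ((ψ.map (Polynomial.mapRingHom (algebraMap ℚ ℂ))).eval (Polynomial.C α)))
            *ᵥ (fun i => algebraMap ℚ ℂ (u i)))
        = α ^ k • ((Polynomial.aeval (A.map (algebraMap ℚ ℂ))
            ((ψ.map (Polynomial.mapRingHom (algebraMap ℚ ℂ))).eval (Polynomial.C α)))
            *ᵥ (fun i => algebraMap ℚ ℂ (u i))) := by
  set B := A.map (algebraMap ℚ ℂ) with hB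
  set g := (ψ.map (Polynomial.mapRingHom (algebraMap ℚ ℂ))).eval (Polynomial.C α) with hg
  have h1 : (X - C α) * g = f.map (algebraMap ℚ ℂ) := by
    have h := congrArg (fun p => (p.map (Polynomial.mapRingHom (algebraMap ℚ ℂ))).eval
      (Polynomial.C α)) hψ
    have h2 : ((f.map (C : ℚ →+* ℚ[X])).map
        (Polynomial.mapRingHom (algebraMap ℚ ℂ))).eval (C α) = 0 := by
      have h3 : (Polynomial.mapRingHom (algebraMap ℚ ℂ)).comp (C : ℚ →+* ℚ[X])
          = (C : ℂ →+* ℂ[X]).comp (algebraMap ℚ ℂ) := by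
        ext; simp
      rw [Polynomial.map_map, h3, ← Polynomial.map_map, Polynomial.eval_map,
        Polynomial.eval₂_at_apply, Polynomial.eval_map, ← Polynomial.aeval_def, hα, C_0]
    simp only [Polynomial.map_mul, Polynomial.map_sub, Polynomial.eval_mul,
      Polynomial.eval_sub, Polynomial.map_C, Polynomial.map_X, Polynomial.eval_C,
      Polynomial.eval_X, h2, sub_zero, Polynomial.coe_mapRingHom] at h
    exact h
  have h4 : aeval B (f.map (algebraMap ℚ ℂ)) = (aeval A f).map (algebraMap ℚ ℂ) := by
    rw [Polynomial.aeval_map_algebraMap]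
    exact Polynomial.aeval_algHom_apply (Algebra.ofId ℚ ℂ).mapMatrix A f
  have h5 : aeval B (f.map (algebraMap ℚ ℂ)) *ᵥ (fun i => algebraMap ℚ ℂ (u i)) = 0 := by
    rw [h4]
    ext i
    have := RingHom.map_mulVec (algebraMap ℚ ℂ) (aeval A f) u i
    rw [hfu] at this
    simpa [Function.comp_def] using this.symm
  rw [← h1, map_mul, ← Matrix.mulVec_mulVec] at h5
  generalize aeval B g *ᵥ (fun i => algebraMap ℚ ℂ (u i)) = v at h5
  have h6 : B *ᵥ v = α • v := by
    simpa [Matrix.sub_mulVec, sub_eq_zero, Algebra.algebraMap_eq_smul_one,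
      Matrix.smul_mulVec] using h5
  intro k
  induction k with
  | zero => simp
  | succ k ih =>
    rw [pow_succ, ← Matrix.mulVec_mulVec, h6, Matrix.mulVec_smul, ih, smul_smul, pow_succ']
end

section
/- Let A be an n×n matrix over ℚ, let f ∈ ℚ[λ] be irreducible of degree d with complex roots α₁, …, α_d, and let u, w ∈ ℚⁿ be nonzero vectors with f(A)·u = 0 and f(A)·w = 0. Then the ℂ-linear spans satisfy span_ℂ{ψ_f(A_ℂ, α_i·E)·u : i = 1,…,d} = span_ℂ{ψ_f(A_ℂ, α_i·E)·w : i = 1,…,d} if and only if w ∈ L_A(u) = span_ℚ{u, A·u, …, A^{d−1}·u}, where A_ℂ denotes A regarded as a complex matrix. -/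
open Polynomial Matrix

/-- The coefficient polynomial of `ψ` at `y = α`. -/
noncomputable def gpol (ψ : Polynomial (Polynomial ℚ)) (α : ℂ) : Polynomial ℂ :=
  (ψ.map (Polynomial.mapRingHom (algebraMap ℚ ℂ))).eval (Polynomial.C α)

lemma gpol_mul (f : Polynomial ℚ) (ψ : Polynomial (Polynomial ℚ))
    (hψ : (Polynomial.C Polynomial.X - Polynomial.X) * ψ
        = Polynomial.C f - f.map Polynomial.C) (α : ℂ) (hα : aeval α f = 0) :
    (X - C α) * gpol ψ α = f.map (algebraMap ℚ ℂ) := by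
  have h := congrArg (fun q => (q.map (Polynomial.mapRingHom (algebraMap ℚ ℂ))).eval
    (Polynomial.C α)) hψ
  have h2 : Polynomial.eval (C α)
      ((f.map Polynomial.C).map (Polynomial.mapRingHom (algebraMap ℚ ℂ))) = 0 := by
    have e : (Polynomial.mapRingHom (algebraMap ℚ ℂ)).comp (Polynomial.C : ℚ →+* ℚ[X])
        = (Polynomial.C : ℂ →+* ℂ[X]).comp (algebraMap ℚ ℂ) := by
      ext x; simp
    rw [Polynomial.map_map, e, ← Polynomial.map_map, Polynomial.eval_map,
      Polynomial.eval₂_hom, Polynomial.eval_map, ← Polynomial.aeval_def, hα, map_zero]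
  simp only [Polynomial.map_mul, Polynomial.map_sub, Polynomial.eval_mul, Polynomial.eval_sub,
    h2, sub_zero] at h
  simpa [gpol] using h

/-- The map `p ↦ p(M) v`. -/
noncomputable def act {n : ℕ} {K : Type*} [Field K] (M : Matrix (Fin n) (Fin n) K)
    (v : Fin n → K) : K[X] →ₗ[K] (Fin n → K) where
  toFun p := aeval M p *ᵥ v
  map_add' p q := by simp [Matrix.add_mulVec]
  map_smul' c p := by simp [Matrix.smul_mulVec]

lemma act_apply {n : ℕ} {K : Type*} [Field K] (M : Matrix (Fin n) (Fin n) K)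
    (v : Fin n → K) (p : K[X]) : act M v p = aeval M p *ᵥ v := rfl

lemma act_mul {n : ℕ} {K : Type*} [Field K] (M : Matrix (Fin n) (Fin n) K)
    (v : Fin n → K) (p q : K[X]) : act M v (p * q) = aeval M p *ᵥ act M v q := by
  simp [act_apply, Matrix.mulVec_mulVec]

lemma act_act {n : ℕ} {K : Type*} [Field K] (M : Matrix (Fin n) (Fin n) K)
    (v : Fin n → K) (p q : K[X]) : act M (act M v q) p = act M v (p * q) := by
  rw [act_mul, act_apply]

lemma act_one {n : ℕ} {K : Type*} [Field K] (M : Matrix (Fin n) (Fin n) K)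
    (v : Fin n → K) : act M v 1 = v := by
  simp [act_apply]

lemma act_map {n : ℕ} (A : Matrix (Fin n) (Fin n) ℚ) (v : Fin n → ℚ) (p : ℚ[X]) :
    act (A.map (algebraMap ℚ ℂ)) (fun i => algebraMap ℚ ℂ (v i)) (p.map (algebraMap ℚ ℂ))
      = fun i => algebraMap ℚ ℂ (act A v p i) := by
  have h : aeval (A.map (algebraMap ℚ ℂ)) (p.map (algebraMap ℚ ℂ))
      = (aeval A p).map (algebraMap ℚ ℂ) := by
    have h1 := Polynomial.aeval_algHom_apply (Algebra.ofId ℚ ℂ).mapMatrix A p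
    rw [Polynomial.aeval_map_algebraMap]
    exact h1
  funext i
  rw [act_apply, h, act_apply]
  exact (RingHom.map_mulVec (algebraMap ℚ ℂ) _ _ i).symm

lemma span_eq {n : ℕ} (A : Matrix (Fin n) (Fin n) ℚ) (f : Polynomial ℚ)
    (hf : Irreducible f) (u : Fin n → ℚ)
    (hfu : (Polynomial.aeval A f) *ᵥ u = 0) (ψ : Polynomial (Polynomial ℚ))
    (hψ : (Polynomial.C Polynomial.X - Polynomial.X) * ψ
        = Polynomial.C f - f.map Polynomial.C) :
    Submodule.span ℂ
        ((fun α : ℂ => act (A.map (algebraMap ℚ ℂ)) (fun i => algebraMap ℚ ℂ (u i)) (gpol ψ α))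
          '' {α : ℂ | Polynomial.aeval α f = 0})
      = LinearMap.range (act (A.map (algebraMap ℚ ℂ)) (fun i => algebraMap ℚ ℂ (u i))) := by
  set M := A.map (algebraMap ℚ ℂ) with hM
  set v : Fin n → ℂ := (fun i => algebraMap ℚ ℂ (u i)) with hv
  have hfv : act M v (f.map (algebraMap ℚ ℂ)) = 0 := by
    rw [hM, hv, act_map, act_apply, hfu]; funext i; simp
  apply le_antisymm
  · rw [Submodule.span_le]
    rintro _ ⟨α, -, rfl⟩
    exact ⟨_, rfl⟩
  set V := Submodule.span ℂ ((fun α : ℂ => act M v (gpol ψ α))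
          '' {α : ℂ | Polynomial.aeval α f = 0}) with hV
  have hX : ∀ x ∈ V, M *ᵥ x ∈ V := by
    intro x hx
    induction hx using Submodule.span_induction with
    | mem x h =>
      obtain ⟨α, hα, rfl⟩ := h
      have h1 := gpol_mul f ψ hψ α hα
      have h2 : M *ᵥ act M v (gpol ψ α) = α • act M v (gpol ψ α) := by
        rw [← h1, act_mul] at hfv
        simp only [map_sub, aeval_X, aeval_C, Matrix.sub_mulVec] at hfv
        rw [Algebra.algebraMap_eq_smul_one, Matrix.smul_mulVec, Matrix.one_mulVec] at hfv
        exact sub_eq_zero.mp hfv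
      simp only
      rw [h2]
      exact V.smul_mem _ (Submodule.subset_span ⟨α, hα, rfl⟩)
    | zero => simp
    | add x y _ _ hx hy => rw [Matrix.mulVec_add]; exact V.add_mem hx hy
    | smul c x _ hx => rw [Matrix.mulVec_smul]; exact V.smul_mem _ hx
  have hP : ∀ p : ℂ[X], ∀ x ∈ V, aeval M p *ᵥ x ∈ V := by
    intro p
    induction p using Polynomial.induction_on' with
    | add p q hp hq =>
      intro x hx
      rw [map_add, Matrix.add_mulVec]
      exact V.add_mem (hp x hx) (hq x hx)
    | monomial k c =>
      intro x hx
      rw [Polynomial.aeval_monomial, Algebra.algebraMap_eq_smul_one, smul_mul_assoc, one_mul,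
        Matrix.smul_mulVec]
      apply V.smul_mem
      induction k with
      | zero => simpa using hx
      | succ k ih =>
        rw [pow_succ', ← Matrix.mulVec_mulVec]
        exact hX _ ih
  let I : Ideal ℂ[X] :=
    { carrier := {p | act M v p ∈ V}
      add_mem' := fun {p q} hp hq => by
        simp only [Set.mem_ofPred_eq, map_add] at *
        exact V.add_mem hp hq
      zero_mem' := by simp
      smul_mem' := fun c p hp => by
        simp only [Set.mem_ofPred_eq, smul_eq_mul] at *
        rw [act_mul]
        exact hP _ _ hp }
  obtain ⟨h, hh⟩ := (inferInstance : I.IsPrincipal)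
  have hdvd : ∀ p, p ∈ I ↔ h ∣ p := by
    intro p
    rw [hh]
    exact Ideal.mem_span_singleton
  have hfI : h ∣ f.map (algebraMap ℚ ℂ) := (hdvd _).1 (by
    change act M v _ ∈ V
    rw [hfv]; exact V.zero_mem)
  have hunit : IsUnit h := by
    by_contra hnu
    have hf0 : f.map (algebraMap ℚ ℂ) ≠ 0 := by
      simpa using hf.ne_zero
    have hh0 : h ≠ 0 := ne_zero_of_dvd_ne_zero hf0 hfI
    have hdeg : h.degree ≠ 0 := fun hd => hnu (Polynomial.isUnit_iff_degree_eq_zero.2 hd)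
    obtain ⟨β, hβ⟩ := IsAlgClosed.exists_root h hdeg
    have hβf : aeval β f = 0 := by
      have : (f.map (algebraMap ℚ ℂ)).IsRoot β := hβ.dvd hfI
      rwa [Polynomial.IsRoot.def, Polynomial.eval_map_algebraMap] at this
    have hg : h ∣ gpol ψ β := (hdvd _).1 (Submodule.subset_span ⟨β, hβf, rfl⟩)
    have hgβ : (gpol ψ β).eval β = 0 := hβ.dvd hg
    have h1 := congrArg Polynomial.derivative (gpol_mul f ψ hψ β hβf)
    have h2 := congrArg (Polynomial.eval β) h1
    rw [Polynomial.derivative_map, Polynomial.eval_map_algebraMap] at h2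
    simp [Polynomial.derivative_mul, hgβ] at h2
    exact hf.separable.aeval_derivative_ne_zero hβf h2.symm
  have h1 : (1 : ℂ[X]) ∈ I := (hdvd _).2 hunit.dvd
  rintro _ ⟨p, rfl⟩
  have : p * 1 ∈ I := I.mul_mem_left p h1
  rw [mul_one] at this
  exact this

lemma descend {n : ℕ} (A : Matrix (Fin n) (Fin n) ℚ) (u : Fin n → ℚ) (φ : ℂ →ₗ[ℚ] ℚ) (p : ℂ[X]) :
    (fun i => φ (act (A.map (algebraMap ℚ ℂ)) (fun i => algebraMap ℚ ℂ (u i)) p i))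
      ∈ LinearMap.range (act A u) := by
  induction p using Polynomial.induction_on' with
  | add p q hp hq =>
    have := Submodule.add_mem _ hp hq
    simpa [Pi.add_def] using this
  | monomial k c =>
    refine ⟨monomial k (φ c), ?_⟩
    have h := act_map A u (X ^ k)
    rw [Polynomial.map_pow, Polynomial.map_X] at h
    funext i
    rw [← Polynomial.C_mul_X_pow_eq_monomial, ← Polynomial.C_mul_X_pow_eq_monomial,
      ← Polynomial.smul_eq_C_mul, ← Polynomial.smul_eq_C_mul, map_smul, map_smul, h]
    simp only [Pi.smul_apply, smul_eq_mul]
    rw [mul_comm c, ← Algebra.smul_def, map_smul, smul_eq_mul, mul_comm]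

lemma krylov {n : ℕ} (A : Matrix (Fin n) (Fin n) ℚ) (f : Polynomial ℚ)
    (hf : f ≠ 0) (hfpos : 0 < f.natDegree) (d : ℕ) (hdeg : f.natDegree = d) (u : Fin n → ℚ)
    (hfu : (Polynomial.aeval A f) *ᵥ u = 0) :
    Submodule.span ℚ (Set.range fun i : Fin d => (A ^ (i : ℕ)) *ᵥ u)
      = LinearMap.range (act A u) := by
  apply le_antisymm
  · rw [Submodule.span_le]
    rintro _ ⟨i, rfl⟩
    exact ⟨X ^ (i : ℕ), by simp [act_apply]⟩
  · rintro _ ⟨p, rfl⟩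
    have h1 : act A u p = act A u (p % f) := by
      conv_lhs => rw [← EuclideanDomain.mod_add_div p f]
      rw [map_add, mul_comm f, act_mul, act_apply A u f, hfu, Matrix.mulVec_zero, add_zero]
    rw [h1]
    have h2 : (p % f).degree < d := by
      rw [← hdeg, ← Polynomial.degree_eq_natDegree hf]
      exact EuclideanDomain.mod_lt p hf
    rw [(p % f).as_sum_range' d (by
      by_cases h0 : p % f = 0
      · rw [h0, Polynomial.natDegree_zero, ← hdeg]
        exact hfpos
      · exact (Polynomial.natDegree_lt_iff_degree_lt h0).2 h2), map_sum]
    refine Submodule.sum_mem _ fun i hi => ?_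
    have : act A u (monomial i ((p % f).coeff i)) = (p % f).coeff i • ((A ^ i) *ᵥ u) := by
      rw [act_apply, Polynomial.aeval_monomial, Algebra.algebraMap_eq_smul_one, smul_mul_assoc, one_mul,
        Matrix.smul_mulVec]
    rw [this]
    exact Submodule.smul_mem _ _ (Submodule.subset_span ⟨⟨i, Finset.mem_range.1 hi⟩, rfl⟩)

lemma range_le {n : ℕ} (A : Matrix (Fin n) (Fin n) ℚ) (u w : Fin n → ℚ)
    (h : w ∈ LinearMap.range (act A u)) :
    LinearMap.range (act (A.map (algebraMap ℚ ℂ)) (fun i => algebraMap ℚ ℂ (w i)))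
      ≤ LinearMap.range (act (A.map (algebraMap ℚ ℂ)) (fun i => algebraMap ℚ ℂ (u i))) := by
  obtain ⟨q, rfl⟩ := h
  rintro _ ⟨p, rfl⟩
  rw [← act_map, act_act]
  exact ⟨_, rfl⟩


/-- span_ℂ{ψ_f(A_ℂ, α_i·E)·u : f(α_i) = 0} = span_ℂ{ψ_f(A_ℂ, α_i·E)·w : f(α_i) = 0}
if and only if w ∈ L_A(u) = span_ℚ{u, A·u, …, A^{d−1}·u}. -/
theorem stmt_10 {n : ℕ} (A : Matrix (Fin n) (Fin n) ℚ) (f : Polynomial ℚ)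
    (hf : Irreducible f) (d : ℕ) (hdeg : f.natDegree = d)
    (u w : Fin n → ℚ) (hu : u ≠ 0) (hw : w ≠ 0)
    (hfu : (Polynomial.aeval A f) *ᵥ u = 0) (hfw : (Polynomial.aeval A f) *ᵥ w = 0)
    (ψ : Polynomial (Polynomial ℚ))
    (hψ : (Polynomial.C Polynomial.X - Polynomial.X) * ψ
        = Polynomial.C f - f.map Polynomial.C) :
    (Submodule.span ℂ
        ((fun α : ℂ => (Polynomial.aeval (A.map (algebraMap ℚ ℂ))
            ((ψ.map (Polynomial.mapRingHom (algebraMap ℚ ℂ))).eval (Polynomial.C α)))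
            *ᵥ (fun i => algebraMap ℚ ℂ (u i)))
          '' {α : ℂ | Polynomial.aeval α f = 0})
      = Submodule.span ℂ
        ((fun α : ℂ => (Polynomial.aeval (A.map (algebraMap ℚ ℂ))
            ((ψ.map (Polynomial.mapRingHom (algebraMap ℚ ℂ))).eval (Polynomial.C α)))
            *ᵥ (fun i => algebraMap ℚ ℂ (w i)))
          '' {α : ℂ | Polynomial.aeval α f = 0}))
    ↔ w ∈ Submodule.span ℚ (Set.range fun i : Fin d => (A ^ (i : ℕ)) *ᵥ u) := by
  change (Submodule.span ℂ
        ((fun α : ℂ => act (A.map (algebraMap ℚ ℂ)) (fun i => algebraMap ℚ ℂ (u i)) (gpol ψ α))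
          '' {α : ℂ | Polynomial.aeval α f = 0}) = Submodule.span ℂ
        ((fun α : ℂ => act (A.map (algebraMap ℚ ℂ)) (fun i => algebraMap ℚ ℂ (w i)) (gpol ψ α))
          '' {α : ℂ | Polynomial.aeval α f = 0})) ↔ _
  rw [span_eq A f hf u hfu ψ hψ, span_eq A f hf w hfw ψ hψ,
    krylov A f hf.ne_zero hf.natDegree_pos d hdeg u hfu]
  constructor
  · intro h
    have h1 : (fun i => algebraMap ℚ ℂ (w i)) ∈ LinearMap.range
        (act (A.map (algebraMap ℚ ℂ)) (fun i => algebraMap ℚ ℂ (u i))) := by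
      rw [h]
      exact ⟨1, act_one _ _⟩
    obtain ⟨p, hp⟩ := h1
    obtain ⟨φ, hφ⟩ := LinearMap.exists_leftInverse_of_injective (Algebra.linearMap ℚ ℂ)
      (LinearMap.ker_eq_bot.2 (algebraMap ℚ ℂ).injective)
    have h2 := descend A u φ p
    rw [hp] at h2
    have h3 : (fun i => φ (algebraMap ℚ ℂ (w i))) = w := by
      funext i
      exact LinearMap.congr_fun hφ (w i)
    rwa [h3] at h2
  · intro h
    refine le_antisymm (range_le A w u ?_) (range_le A u w h)
    obtain ⟨p, hp⟩ := h
    have hnd : ¬ f ∣ p := by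
      rintro ⟨q, rfl⟩
      apply hw
      rw [← hp, mul_comm, act_mul, act_apply A u f, hfu, Matrix.mulVec_zero]
    obtain ⟨a, b, hab⟩ := (hf.coprime_iff_not_dvd).2 hnd
    refine ⟨b, ?_⟩
    rw [← hp, act_act]
    have h4 : act A u (a * f + b * p) = u := by rw [hab, act_one]
    rwa [map_add, act_mul A u a f, act_apply A u f, hfu, Matrix.mulVec_zero, zero_add] at h4
end

section
/- Let A be an n×n matrix over ℚ, let f ∈ ℚ[λ] be irreducible of degree d, and suppose the characteristic polynomial of A factors as χ_A = f^m · h with f not dividing h. If f² does not divide the minimal polynomial of A, then the kernel of f(A) (as a ℚ-subspace of ℚⁿ) has dimension m·d. -/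
open Polynomial Matrix

lemma aux_dvd {K : Type*} [Field K] {V : Type*} [AddCommGroup V] [Module K V] [FiniteDimensional K V]
    (φ : Module.End K V) (p q : Polynomial K) (hp : Irreducible p)
    (h1 : p ∣ φ.charpoly) (h2 : aeval φ q = 0) : p ∣ q := by
  have : Fact (Irreducible p) := ⟨hp⟩
  have hα : ∀ r : Polynomial K, aeval (AdjoinRoot.root p) r = 0 ↔ p ∣ r := by
    intro r
    rw [AdjoinRoot.aeval_eq, AdjoinRoot.mk_eq_zero]
  let L := AdjoinRoot p
  let α : L := AdjoinRoot.root p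
  let ψ : Module.End L (TensorProduct K L V) := φ.baseChange L
  have hroot : ψ.charpoly.IsRoot α := by
    have : ψ.charpoly = φ.charpoly.map (algebraMap K L) := LinearMap.charpoly_baseChange φ L
    rw [this, IsRoot, eval_map_algebraMap]
    exact (hα _).2 h1
  rw [← Module.End.hasEigenvalue_iff_isRoot_charpoly] at hroot
  obtain ⟨v, hv⟩ := hroot.exists_hasEigenvector
  have h3 := Module.End.aeval_apply_of_hasEigenvector (p := q.map (algebraMap K L)) hv
  have h4 : aeval ψ (q.map (algebraMap K L)) = 0 := by
    rw [aeval_map_algebraMap]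
    have := aeval_algHom_apply (Module.End.baseChangeHom K L V) φ q
    rw [h2, map_zero] at this
    exact this
  rw [h4, LinearMap.zero_apply] at h3
  have h5 := (smul_eq_zero.mp h3.symm).resolve_right hv.2
  rw [eval_map_algebraMap] at h5
  exact (hα q).1 h5

lemma aux_restrict {V : Type*} [AddCommGroup V] [Module ℚ V]
    (φ : Module.End ℚ V) (W : Submodule ℚ V) (h : ∀ x ∈ W, φ x ∈ W) (q : Polynomial ℚ)
    (x : W) : ((aeval (φ.restrict h) q x : W) : V) = aeval φ q (x : V) := by
  induction q using Polynomial.induction_on' with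
  | add p q hp hq => simp [hp, hq]
  | monomial n a =>
    simp only [aeval_monomial, Module.End.mul_apply, Module.algebraMap_end_apply,
      Submodule.coe_smul]
    congr 1
    rw [Module.End.pow_restrict]
    rfl

lemma aux_charpoly {V : Type*} [AddCommGroup V] [Module ℚ V] [FiniteDimensional ℚ V]
    (φ : Module.End ℚ V) (U W : Submodule ℚ V) (hU : ∀ x ∈ U, φ x ∈ U)
    (hW : ∀ x ∈ W, φ x ∈ W) (hc : IsCompl U W) :
    φ.charpoly = (φ.restrict hU).charpoly * (φ.restrict hW).charpoly := by
  let e := Submodule.prodEquivOfIsCompl U W hc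
  have hψ : (φ.restrict hU).prodMap (φ.restrict hW) = e.symm.conj φ := by
    apply LinearMap.ext
    rintro ⟨x, y⟩
    rw [LinearEquiv.conj_apply, LinearEquiv.symm_symm, LinearMap.comp_apply, LinearMap.comp_apply,
      LinearEquiv.coe_coe, LinearEquiv.coe_coe, LinearEquiv.eq_symm_apply]
    simp only [e, Submodule.coe_prodEquivOfIsCompl', LinearMap.prodMap_apply, map_add,
      LinearMap.coe_restrict_apply]
  rw [← e.symm.charpoly_conj φ, ← hψ, LinearMap.charpoly_prodMap]

lemma aux_pow (f : Polynomial ℚ) (hf : Irreducible f) (c : Polynomial ℚ) (hc : c ≠ 0)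
    (H : ∀ p, Irreducible p → p ∣ c → p ∣ f) : ∃ k, Associated c (f ^ k) := by
  obtain ⟨k, r, hr, he⟩ := (FiniteMultiplicity.of_prime_left hf.prime hc).exists_eq_pow_mul_and_not_dvd.imp
    (fun r hr => hr) |> fun ⟨r, h1, h2⟩ => (⟨_, r, h2, h1⟩ : ∃ k r, ¬ f ∣ r ∧ c = f ^ k * r)
  refine ⟨k, ?_⟩
  have hu : IsUnit r := by
    by_contra hu
    have hr0 : r ≠ 0 := by rintro rfl; simp at hr
    obtain ⟨p, hp, hpr⟩ := WfDvdMonoid.exists_irreducible_factor hu hr0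
    have := H p hp (he ▸ hpr.mul_left _)
    exact hr ((hp.dvd_symm hf this).trans hpr)
  rw [he]
  exact associated_mul_unit_left _ _ hu

theorem aux_main {V : Type*} [AddCommGroup V] [Module ℚ V] [FiniteDimensional ℚ V]
    (φ : Module.End ℚ V) (f : Polynomial ℚ) (hf : Irreducible f)
    (m : ℕ) (h : Polynomial ℚ) (hchar : φ.charpoly = f ^ m * h)
    (hnd : ¬ f ∣ h) (hmp : ¬ f ^ 2 ∣ minpoly ℚ φ) :
    Module.finrank ℚ (LinearMap.ker (aeval φ f)) = m * f.natDegree := by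
  obtain ⟨g, hg, hfg⟩ : ∃ g, ¬ f ∣ g ∧ aeval φ (f * g) = 0 := by
    by_cases hd : f ∣ minpoly ℚ φ
    · obtain ⟨g, hg⟩ := hd
      refine ⟨g, fun ⟨r, hr⟩ => hmp ⟨r, ?_⟩, ?_⟩
      · rw [hg, hr]; ring
      · rw [← hg, minpoly.aeval]
    · exact ⟨_, hd, by simp⟩
  have hcop : IsCoprime f g := (hf.coprime_iff_not_dvd).2 hg
  have hinv : ∀ q : Polynomial ℚ, ∀ x ∈ LinearMap.ker (aeval φ q),
      φ x ∈ LinearMap.ker (aeval φ q) := by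
    intro q x hx
    rw [LinearMap.mem_ker] at hx ⊢
    have : aeval φ (q * X) x = aeval φ (X * q) x := by rw [mul_comm]
    simpa [hx] using this
  have hz : ∀ q : Polynomial ℚ, aeval (φ.restrict (hinv q)) q = 0 := by
    intro q
    apply LinearMap.ext
    intro x
    apply Subtype.ext
    rw [aux_restrict]
    exact x.2
  have hc : IsCompl (LinearMap.ker (aeval φ f)) (LinearMap.ker (aeval φ g)) := by
    refine ⟨disjoint_ker_aeval_of_isCoprime φ hcop, ?_⟩
    rw [codisjoint_iff, sup_ker_aeval_eq_ker_aeval_mul_of_coprime φ hcop, hfg, LinearMap.ker_zero]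
  have hchi := aux_charpoly φ _ _ (hinv f) (hinv g) hc
  set χ₁ := (φ.restrict (hinv f)).charpoly with h1
  set χ₂ := (φ.restrict (hinv g)).charpoly with h2
  have hn1 : χ₁ ≠ 0 := (LinearMap.charpoly_monic _).ne_zero
  obtain ⟨k, hk⟩ := aux_pow f hf χ₁ hn1 (fun p hp hpd => aux_dvd _ p f hp hpd (hz f))
  have h2d : ¬ f ∣ χ₂ := fun hd => hg (aux_dvd _ f g hf hd (hz g))
  have hkm : k = m := by
    have e1 : emultiplicity f (f ^ k * χ₂) = k := by
      rw [emultiplicity_mul hf.prime, emultiplicity_pow_self_of_prime hf.prime,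
        emultiplicity_eq_zero.2 h2d, add_zero]
    have e2 : emultiplicity f (f ^ m * h) = m := by
      rw [emultiplicity_mul hf.prime, emultiplicity_pow_self_of_prime hf.prime,
        emultiplicity_eq_zero.2 hnd, add_zero]
    have e3 : Associated (f ^ m * h) (f ^ k * χ₂) := by
      rw [← hchar, hchi]; exact hk.mul_right _
    rw [← emultiplicity_eq_of_associated_right e3, e2] at e1
    exact_mod_cast e1.symm
  have hd := natDegree_eq_of_degree_eq (degree_eq_degree_of_associated hk)
  rw [h1, LinearMap.charpoly_natDegree, natDegree_pow, hkm] at hd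
  exact hd



/-- if χ_A = f^m·h with f irreducible of degree d, f ∤ h, and
f² ∤ minpoly(A), then ker f(A) has dimension m·d over ℚ. -/
theorem stmt_14 {n : ℕ} (A : Matrix (Fin n) (Fin n) ℚ) (f : Polynomial ℚ)
    (hf : Irreducible f) (d : ℕ) (hdeg : f.natDegree = d)
    (m : ℕ) (h : Polynomial ℚ) (hchar : A.charpoly = f ^ m * h)
    (hnd : ¬ f ∣ h) (hmp : ¬ f ^ 2 ∣ minpoly ℚ A) :
    Module.finrank ℚ (LinearMap.ker ((Polynomial.aeval A f).mulVecLin)) = m * d := by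
  subst hdeg
  have key : (aeval A f).mulVecLin = aeval (Matrix.toLin' A) f :=
    (aeval_algHom_apply (Matrix.toLinAlgEquiv' (R := ℚ) (n := Fin n)).toAlgHom A f).symm
  rw [key]
  exact aux_main _ f hf m h (by rw [Matrix.charpoly_toLin', hchar]) hnd
    (by rwa [Matrix.minpoly_toLin'])
end

section
/- Let A be an n×n matrix over ℚ, let f ∈ ℚ[λ] be irreducible, and suppose the characteristic polynomial of A factors as χ_A = f^m · h with f not dividing h. If f² does not divide the minimal polynomial of A, then for every complex root α of f, the eigenspace ker(A_ℂ − α·E) over ℂ has dimension m, where A_ℂ is A regarded as a complex matrix; i.e., the geometric multiplicity of each root of f equals its algebraic multiplicity m. -/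
open Polynomial Matrix

lemma aux_maxGen {V : Type*} [AddCommGroup V] [Module ℂ V] (φ : Module.End ℂ V) (α : ℂ)
    (Q : ℂ[X]) (hQ : Q.eval α ≠ 0) (hz : aeval φ ((X - C α) * Q) = 0) :
    φ.maxGenEigenspace α = φ.eigenspace α := by
  apply le_antisymm
  · intro v hv
    rw [Module.End.mem_maxGenEigenspace] at hv
    obtain ⟨k, hk⟩ := hv
    have hcop : IsCoprime ((X - C α) ^ k) Q := by
      apply IsCoprime.pow_left
      rw [(irreducible_X_sub_C α).coprime_iff_not_dvd, dvd_iff_isRoot]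
      exact hQ
    obtain ⟨a, b, hab⟩ := hcop
    have hX : aeval φ (X - C α) = φ - α • 1 := by
      simp [Algebra.algebraMap_eq_smul_one]
    rw [Module.End.mem_eigenspace_iff]
    have h1 : aeval φ ((X - C α) * (a * (X - C α) ^ k + b * Q)) v = aeval φ (X - C α) v := by
      rw [hab, mul_one]
    have h2 : (X - C α) * (a * (X - C α) ^ k + b * Q)
        = (X - C α) * a * (X - C α) ^ k + b * ((X - C α) * Q) := by ring
    rw [h2, map_add, map_mul, map_mul _ b, hz, map_pow, hX, mul_zero, add_zero,
      Module.End.mul_apply, hk, map_zero] at h1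
    have h3 : φ v - α • v = 0 := by simpa using h1.symm
    exact sub_eq_zero.mp h3
  · exact φ.genEigenspace_le_maximal α 1

/-- if χ_A = f^m·h with f irreducible, f ∤ h, and f² ∤ minpoly(A),
then for every complex root α of f the eigenspace ker(A_ℂ − α·E) has dimension m. -/
theorem stmt_15 {n : ℕ} (A : Matrix (Fin n) (Fin n) ℚ) (f : Polynomial ℚ)
    (hf : Irreducible f) (m : ℕ) (h : Polynomial ℚ) (hchar : A.charpoly = f ^ m * h)
    (hnd : ¬ f ∣ h) (hmp : ¬ f ^ 2 ∣ minpoly ℚ A) :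
    ∀ α : ℂ, Polynomial.aeval α f = 0 →
      Module.finrank ℂ
        (LinearMap.ker
          ((A.map (algebraMap ℚ ℂ) - α • (1 : Matrix (Fin n) (Fin n) ℂ)).mulVecLin))
        = m := by
  intro α hα
  have hroot : ∀ q : ℚ[X], ¬ f ∣ q → (q.map (algebraMap ℚ ℂ)).eval α ≠ 0 := by
    intro q hq h0
    rw [eval_map_algebraMap] at h0
    obtain ⟨a, b, hab⟩ := (hf.coprime_iff_not_dvd).2 hq
    have := congrArg (aeval α) hab
    simp [hα, h0] at this
  obtain ⟨g, hg⟩ : (X - C α) ∣ f.map (algebraMap ℚ ℂ) := by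
    rw [dvd_iff_isRoot, IsRoot, eval_map_algebraMap, hα]
  have hgα : g.eval α ≠ 0 := by
    intro h0
    have hs : (f.map (algebraMap ℚ ℂ)).Separable := hf.separable.map
    obtain ⟨a, b, hab⟩ := hs
    have := congrArg (eval α) hab
    rw [hg] at this
    simp [h0] at this
  obtain ⟨q, hq, hpq⟩ : ∃ q, ¬ f ∣ q ∧ minpoly ℚ A ∣ f * q := by
    by_cases hd : f ∣ minpoly ℚ A
    · obtain ⟨q, hq⟩ := hd
      refine ⟨q, fun hfq => hmp ?_, hq.dvd⟩
      rw [hq, pow_two]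
      exact mul_dvd_mul_left f hfq
    · exact ⟨_, hd, dvd_mul_left _ _⟩
  have hann : aeval A (f * q) = 0 := by
    rwa [← minpoly.dvd_iff]
  set B := A.map (algebraMap ℚ ℂ) with hB
  have hannB : aeval B ((f * q).map (algebraMap ℚ ℂ)) = 0 := by
    have h1 := Polynomial.aeval_algHom_apply ((Algebra.ofId ℚ ℂ).mapMatrix (m := Fin n)) A (f * q)
    rw [hann, map_zero] at h1
    rw [aeval_map_algebraMap]
    exact h1
  have hannL : aeval (toLin' B) ((X - C α) * (g * q.map (algebraMap ℚ ℂ))) = 0 := by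
    have h1 := Polynomial.aeval_algHom_apply (toLinAlgEquiv' (R := ℂ) (n := Fin n)).toAlgHom B
      ((f * q).map (algebraMap ℚ ℂ))
    rw [hannB, map_zero, Polynomial.map_mul, hg, mul_assoc] at h1
    exact h1
  have hker : LinearMap.ker ((B - α • (1 : Matrix (Fin n) (Fin n) ℂ)).mulVecLin)
      = Module.End.eigenspace (toLin' B) α := by
    ext v
    simp [Module.End.mem_eigenspace_iff, sub_mulVec, sub_eq_zero, smul_mulVec]
  rw [hker, ← aux_maxGen _ α (g * q.map (algebraMap ℚ ℂ)) _ hannL,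
    LinearMap.finrank_maxGenEigenspace_eq, charpoly_toLin']
  · have hBc : B.charpoly = (X - C α) ^ m * (g ^ m * h.map (algebraMap ℚ ℂ)) := by
      have := Matrix.charpoly_map A (algebraMap ℚ ℂ)
      rw [hB, this, hchar, Polynomial.map_mul, Polynomial.map_pow, hg, mul_pow, mul_assoc]
    have hne : (g ^ m * h.map (algebraMap ℚ ℂ)).eval α ≠ 0 := by
      rw [eval_mul, eval_pow]
      exact mul_ne_zero (pow_ne_zero _ hgα) (hroot h hnd)
    have h0 : B.charpoly ≠ 0 := B.charpoly_monic.ne_zero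
    rw [hBc] at h0 ⊢
    rw [rootMultiplicity_mul h0, rootMultiplicity_X_sub_C_pow, rootMultiplicity_eq_zero hne,
      add_zero]
  · rw [eval_mul]
    exact mul_ne_zero hgα (hroot q hq)
end
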